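/- Let S ⊆ E be an upper set and let 𝒞 be a family of boxes, each of which is maximal in S, such that the union of the boxes in 𝒞 equals S. Then 𝒞 is exactly the family of all boxes maximal in S. (Hence the abbreviated d.n.f. of a monotone quasi-Boolean function is its unique dead-end d.n.f.) -/

import Mathlib

/-- `B ⊆ Fin n → Fin k` is a box (interval/sublattice of the `n`-dimensional `k`-lattice):
`B = {x | ∀ j, x j ∈ M j}` with every `M j` nonempty. -/
def IsBox {n k : ℕ} (B : Set (Fin n → Fin k)) : Prop :=
  ∃ M : Fin n → Set (Fin k), (∀ j, (M j).Nonempty) ∧ B = {x | ∀ j, x j ∈ M j}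

/-- `B` is a box maximal in `S`: `B ⊆ S` and no box strictly between `B` and `S`. -/
def MaximalBoxIn {n k : ℕ} (S B : Set (Fin n → Fin k)) : Prop :=
  IsBox B ∧ B ⊆ S ∧ ∀ B' : Set (Fin n → Fin k), IsBox B' → B ⊂ B' → ¬B' ⊆ S

theorem isBox_Ici {n k : ℕ} (a : Fin n → Fin k) : IsBox (Set.Ici a) :=
  ⟨fun j => Set.Ici (a j), fun _ => Set.nonempty_Ici, rfl⟩

theorem IsBox.exists_isLeast {n k : ℕ} {B : Set (Fin n → Fin k)} (hB : IsBox B) :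
    ∃ a, IsLeast B a := by
  obtain ⟨M, hM, rfl⟩ := hB
  choose a ha using fun j => (M j).toFinite.exists_minimal (hM j)
  exact ⟨a, fun j => (ha j).prop, fun x hx j => (minimal_iff_isLeast.mp (ha j)).2 (hx j)⟩

theorem MaximalBoxIn.eq_of_subset {n k : ℕ} {S B B' : Set (Fin n → Fin k)}
    (hB : MaximalBoxIn S B) (hB' : IsBox B') (hsub : B ⊆ B') (hS : B' ⊆ S) : B = B' := by
  by_contra hne
  exact hB.2.2 B' hB' (hsub.ssubset_of_ne hne) hS

/-- A maximal box of an upper set is a principal upper set. -/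
theorem MaximalBoxIn.exists_eq_Ici {n k : ℕ} {S B : Set (Fin n → Fin k)}
    (hS : IsUpperSet S) (hB : MaximalBoxIn S B) : ∃ a ∈ S, B = Set.Ici a := by
  obtain ⟨a, ha⟩ := hB.1.exists_isLeast
  have haS : a ∈ S := hB.2.1 ha.1
  exact ⟨a, haS, hB.eq_of_subset (isBox_Ici a) (fun _ hx => ha.2 hx) (hS.Ici_subset haS)⟩

/-- Theorem 1(b): if a family `𝒞` of boxes, each maximal in an upper set `S`, covers `S`
exactly, then `𝒞` is the family of all boxes maximal in `S` (uniqueness of the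
dead-end d.n.f. of a monotone quasi-Boolean function). -/
theorem cover_by_maximal_boxes_unique {n k : ℕ} (hk : 1 ≤ k)
    (S : Set (Fin n → Fin k)) (hS : IsUpperSet S)
    (𝒞 : Set (Set (Fin n → Fin k)))
    (h𝒞 : ∀ B ∈ 𝒞, MaximalBoxIn S B)
    (hcov : ⋃₀ 𝒞 = S) :
    𝒞 = {B | MaximalBoxIn S B} := by
  refine Set.Subset.antisymm h𝒞 fun B hB => ?_
  obtain ⟨a, haS, rfl⟩ := MaximalBoxIn.exists_eq_Ici hS hB
  obtain ⟨C, hC, haC⟩ : a ∈ ⋃₀ 𝒞 := hcov ▸ haS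
  obtain ⟨c, -, rfl⟩ := (h𝒞 C hC).exists_eq_Ici hS
  rwa [hB.eq_of_subset (isBox_Ici c) (Set.Ici_subset_Ici.mpr haC) (h𝒞 _ hC).2.1]
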